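/- Let α > 2, let ε > 0, let θ : ℕ → ℝ satisfy 0 < θ(n) ≤ 2π for all n, and let b : ℕ → ℝ satisfy 1 ≤ b(n) ≤ n for all n ≥ 1. Then n^{−ε} · min{ max{ √n · θ(n)^{−2/α}, b(n) }, n } = O( max{ min{ √(log n / n) · θ(n)^{−2/α}, 1 } · (n / log n), b(n) } ) as n → ∞. -/

import Mathlib

open Asymptotics Filter

/-- Once `1 ≤ log N`, the hop length `min (√(log N / N) * t) 1` scaled by `N / log N` is at least
`min (√N * t) N / log N`. -/
theorem min_sqrt_mul_div_log_le {N t : ℝ} (hN : 0 < N) (hL : 1 ≤ Real.log N) (ht : 0 ≤ t) :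
    min (√N * t) N / Real.log N ≤
      min (√(Real.log N / N) * t) 1 * (N / Real.log N) := by
  have hsqrt : √N ≤ √(Real.log N / N) * N := by
    have h : √(Real.log N / N) * N = √(Real.log N) * √N := by
      rw [Real.sqrt_div (by linarith), div_mul_eq_mul_div, mul_div_assoc, Real.div_sqrt]
    rw [h]
    exact le_mul_of_one_le_left (Real.sqrt_nonneg N) (Real.one_le_sqrt.mpr hL)
  rw [← mul_div_assoc, min_mul_of_nonneg _ _ hN.le, one_mul]
  refine div_le_div_of_nonneg_right (min_le_min_right N ?_) (by linarith)
  calc √N * t ≤ √(Real.log N / N) * N * t := by gcongr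
    _ = √(Real.log N / N) * t * N := by ring

/-- Any negative power of `n` eventually beats `log n`. -/
theorem eventually_rpow_neg_mul_log_le_one {ε : ℝ} (hε : 0 < ε) :
    ∀ᶠ n : ℕ in atTop, (n : ℝ) ^ (-ε) * Real.log n ≤ 1 := by
  have h := ((isLittleO_log_rpow_atTop hε).comp_tendsto
    tendsto_natCast_atTop_atTop).bound one_pos
  filter_upwards [h, eventually_gt_atTop 0] with n hn hpos
  have hn0 : (0 : ℝ) < n := Nat.cast_pos.mpr hpos
  have hpow : 0 < (n : ℝ) ^ ε := Real.rpow_pos_of_pos hn0 ε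
  simp only [Function.comp_apply, Real.norm_eq_abs, one_mul, abs_of_pos hpow] at hn
  rw [Real.rpow_neg hn0.le, inv_mul_le_iff₀ hpow, mul_one]
  exact (le_abs_self _).trans hn

/-- Algebraic core of Theorem 3: the claimed hybrid-network throughput
min{max{√n·θ^{-2/α}, b(n)}, n}·n^{-ε} is dominated by
max{d_hop(n)·n/log n, b(n)} with d_hop(n) = min{√(log n / n)·θ(n)^{-2/α}, 1}. -/
theorem throughput_hybrid_core (α ε : ℝ) (hα : 2 < α) (hε : 0 < ε) (θ b : ℕ → ℝ)
    (hθ : ∀ n, 0 < θ n ∧ θ n ≤ 2 * Real.pi)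
    (hb : ∀ n : ℕ, 1 ≤ n → 1 ≤ b n ∧ b n ≤ (n : ℝ)) :
    (fun n : ℕ => (n : ℝ) ^ (-ε) *
        min (max (Real.sqrt n * θ n ^ (-(2 / α))) (b n)) (n : ℝ))
      =O[atTop] fun n : ℕ =>
        max (min (Real.sqrt (Real.log n / n) * θ n ^ (-(2 / α))) 1 * ((n : ℝ) / Real.log n))
          (b n) := by
  have hlog : ∀ᶠ n : ℕ in atTop, 1 ≤ Real.log n :=
    (Real.tendsto_log_atTop.comp tendsto_natCast_atTop_atTop).eventually_ge_atTop 1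
  refine IsBigO.of_bound 1 ?_
  filter_upwards [hlog, eventually_rpow_neg_mul_log_le_one hε, eventually_ge_atTop 1]
    with n hL hpL hn
  have hN : (1 : ℝ) ≤ n := by exact_mod_cast hn
  have hN0 : (0 : ℝ) < n := by linarith
  have hb0 : 0 ≤ b n := by linarith [(hb n hn).1]
  have ht : 0 ≤ θ n ^ (-(2 / α)) := Real.rpow_nonneg (hθ n).1.le _
  have hkey := min_sqrt_mul_div_log_le hN0 hL ht
  generalize θ n ^ (-(2 / α)) = t at ht hkey ⊢
  have hp0 : 0 ≤ (n : ℝ) ^ (-ε) := Real.rpow_nonneg hN0.le _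
  have hp1 : (n : ℝ) ^ (-ε) ≤ 1 := Real.rpow_le_one_of_one_le_of_nonpos hN (by linarith)
  have hp : (n : ℝ) ^ (-ε) ≤ 1 / Real.log n := (le_div_iff₀ (by linarith)).mpr hpL
  rw [one_mul, Real.norm_of_nonneg (by positivity),
    Real.norm_of_nonneg (le_max_of_le_right hb0), min_comm, min_max_distrib_left,
    mul_max_of_nonneg _ _ hp0, min_comm (n : ℝ), min_comm (n : ℝ)]
  refine max_le_max (le_trans ?_ hkey) ?_
  · calc (n : ℝ) ^ (-ε) * min (√n * t) n ≤ 1 / Real.log n * min (√n * t) n := by gcongr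
      _ = min (√n * t) n / Real.log n := by ring
  · calc (n : ℝ) ^ (-ε) * min (b n) n ≤ 1 * b n := by
          gcongr
          exact min_le_left _ _
      _ = b n := one_mul _
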